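/- For third-order tensors Y ∈ ℝ^{d×n×n₃}, D ∈ ℝ^{d×K×n₃}, X ∈ ℝ^{K×n×n₃} and λ > 0, the sparse-coding objective satisfies, for all X, n₃ · (‖Y − D*X‖_F² + λ‖X‖_{1,1,2}) = Σ_{ω∈ℤ/n₃ℤ} ‖Ŷ(:,:,ω) − D̂(:,:,ω)X̂(:,:,ω)‖_F² + λ√n₃ · Σ_{i,j} ‖X̂(i,j,:)‖₂; consequently minimizing ‖Y − D*X‖_F² + λ‖X‖_{1,1,2} over X is equivalent to minimizing the Fourier-domain objective ‖Ȳ − D̄X̄‖_F² + λ√n₃ ‖X̂‖_{1,1,2}, where the barred quantities denote the block-diagonal matrices formed from the frontal slices of the DFTs. -/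

import Mathlib

open scoped BigOperators

noncomputable section

/-- A third-order real tensor of size `n₁ × n₂ × n₃`, with cyclic third index. -/
abbrev T3 (n1 n2 n3 : ℕ) := Fin n1 → Fin n2 → ZMod n3 → ℝ

/-- The t-product of two third-order tensors:
`C(i,j,:) = ∑ₖ A(i,k,:) ⊛ B(k,j,:)` where `⊛` is circular convolution. -/
def tProd {n1 n2 n4 n3 : ℕ} [NeZero n3] (A : T3 n1 n2 n3) (B : T3 n2 n4 n3) :
    T3 n1 n4 n3 :=
  fun i j t => ∑ k : Fin n2, ∑ s : ZMod n3, A i k s * B k j (t - s)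

/-- Unnormalized DFT along the third dimension:
`Â(i,j,ω) = ∑ₜ A(i,j,t) e^{-2πiωt/n₃}`. -/
def dft {n1 n2 n3 : ℕ} [NeZero n3] (A : T3 n1 n2 n3) :
    Fin n1 → Fin n2 → ZMod n3 → ℂ :=
  fun i j ω => ∑ t : ZMod n3, (A i j t : ℂ) *
    Complex.exp (-2 * Real.pi * Complex.I * ((ω.val : ℂ) * (t.val : ℂ)) / (n3 : ℂ))

/-- Tensor transpose: `Aᵀ(i,j,t) = A(j,i,-t)`, i.e. transpose each frontal slice
and reverse the order of frontal slices `2 … n₃`. -/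
def tT {n1 n2 n3 : ℕ} (A : T3 n1 n2 n3) : T3 n2 n1 n3 :=
  fun i j t => A j i (-t)

/-- The identity tensor: first frontal slice is the identity matrix, others zero. -/
def idT (n n3 : ℕ) : T3 n n n3 :=
  fun i j t => if i = j ∧ t = 0 then 1 else 0

/-- An orthogonal tensor: `Qᵀ*Q = Q*Qᵀ = I`. -/
def IsOrthogonalT {n n3 : ℕ} [NeZero n3] (Q : T3 n n n3) : Prop :=
  tProd (tT Q) Q = idT n n3 ∧ tProd Q (tT Q) = idT n n3

/-- Squared Frobenius norm of a third-order tensor. -/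
def frobSq {n1 n2 n3 : ℕ} [NeZero n3] (A : T3 n1 n2 n3) : ℝ :=
  ∑ i : Fin n1, ∑ j : Fin n2, ∑ t : ZMod n3, (A i j t) ^ 2

/-- f-diagonal tensor: every frontal slice is a diagonal matrix. -/
def IsFDiagonal {n1 n2 n3 : ℕ} (S : T3 n1 n2 n3) : Prop :=
  ∀ (i : Fin n1) (j : Fin n2), (i : ℕ) ≠ (j : ℕ) → ∀ t : ZMod n3, S i j t = 0

/-- Euclidean norm of the `(i,j)`-th tube `A(i,j,:)` of a tensor. -/
def tubeNorm {n1 n2 n3 : ℕ} [NeZero n3] (A : T3 n1 n2 n3) (i : Fin n1) (j : Fin n2) : ℝ :=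
  Real.sqrt (∑ t : ZMod n3, (A i j t) ^ 2)

/-- The `‖·‖_{1,1,2}` norm: the sum of the Euclidean norms of all tubes. -/
def norm112 {n1 n2 n3 : ℕ} [NeZero n3] (A : T3 n1 n2 n3) : ℝ :=
  ∑ i : Fin n1, ∑ j : Fin n2, tubeNorm A i j

/-- The spatial-domain sparse-coding objective `‖Y − D*X‖_F² + λ‖X‖_{1,1,2}`. -/
def spObj {d n K n3 : ℕ} [NeZero n3] (Y : T3 d n n3) (D : T3 d K n3) (lam : ℝ)
    (X : T3 K n n3) : ℝ :=
  frobSq (Y - tProd D X) + lam * norm112 X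

/-- The Fourier-domain objective `‖Ȳ − D̄X̄‖_F² + λ√n₃‖X̂‖_{1,1,2}`: the
Frobenius norm of the block-diagonal matrix `Ȳ − D̄X̄` is the sum over the
frontal slices `Ŷ(:,:,ω) − D̂(:,:,ω)X̂(:,:,ω)`, and `‖X̂‖_{1,1,2}` sums the
`ℓ²` norms of the tubes `X̂(i,j,:)`. -/
def fObj {d n K n3 : ℕ} [NeZero n3] (Y : T3 d n n3) (D : T3 d K n3) (lam : ℝ)
    (X : T3 K n n3) : ℝ :=
  (∑ ω : ZMod n3, ∑ i : Fin d, ∑ j : Fin n,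
      ‖dft Y i j ω - ∑ l : Fin K, dft D i l ω * dft X l j ω‖ ^ 2) +
    lam * Real.sqrt (n3 : ℝ) *
      ∑ i : Fin K, ∑ j : Fin n, Real.sqrt (∑ ω : ZMod n3, ‖dft X i j ω‖ ^ 2)

theorem dft_eq_sum_stdAddChar {n1 n2 n3 : ℕ} [NeZero n3] (A : T3 n1 n2 n3)
    (i : Fin n1) (j : Fin n2) (ω : ZMod n3) :
    dft A i j ω = ∑ t : ZMod n3, (A i j t : ℂ) * ZMod.stdAddChar (t * -ω) := by
  refine Finset.sum_congr rfl fun t _ => ?_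
  have h : t * -ω = ((-(ω.val * t.val : ℤ) : ℤ) : ZMod n3) := by
    push_cast
    rw [ZMod.natCast_zmod_val, ZMod.natCast_zmod_val]
    ring
  rw [h, ZMod.stdAddChar_coe]
  congr 2
  push_cast
  ring

theorem dft_sub {n1 n2 n3 : ℕ} [NeZero n3] (A B : T3 n1 n2 n3)
    (i : Fin n1) (j : Fin n2) (ω : ZMod n3) :
    dft (A - B) i j ω = dft A i j ω - dft B i j ω := by
  simp only [dft, Pi.sub_apply, Complex.ofReal_sub, sub_mul, Finset.sum_sub_distrib]

/-- The convolution theorem: the DFT turns the t-product into slicewise matrix products. -/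
theorem dft_tProd {n1 n2 n4 n3 : ℕ} [NeZero n3] (A : T3 n1 n2 n3) (B : T3 n2 n4 n3)
    (i : Fin n1) (j : Fin n4) (ω : ZMod n3) :
    dft (tProd A B) i j ω = ∑ l : Fin n2, dft A i l ω * dft B l j ω := by
  simp only [dft_eq_sum_stdAddChar, tProd, Complex.ofReal_sum, Complex.ofReal_mul, Finset.sum_mul]
  rw [Finset.sum_comm]
  refine Finset.sum_congr rfl fun l _ => ?_
  rw [Finset.sum_comm]
  refine Finset.sum_congr rfl fun s _ => ?_
  rw [Finset.mul_sum, ← Equiv.sum_comp (Equiv.addRight s)]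
  refine Finset.sum_congr rfl fun t _ => ?_
  rw [Equiv.coe_addRight, add_sub_cancel_right, add_mul, AddChar.map_add_eq_mul]
  ring

/-- Parseval's identity for the unnormalized DFT of a tube. -/
theorem sum_norm_dft_sq {n1 n2 n3 : ℕ} [NeZero n3] (A : T3 n1 n2 n3)
    (i : Fin n1) (j : Fin n2) :
    ∑ ω : ZMod n3, ‖dft A i j ω‖ ^ 2 = n3 * ∑ t : ZMod n3, A i j t ^ 2 := by
  have key (ω : ZMod n3) : ((‖dft A i j ω‖ ^ 2 : ℝ) : ℂ) = ∑ t : ZMod n3, ∑ s : ZMod n3,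
      (A i j t : ℂ) * A i j s * ZMod.stdAddChar (ω * (s - t)) := by
    rw [Complex.ofReal_pow, ← Complex.mul_conj', dft_eq_sum_stdAddChar, map_sum,
      Finset.sum_mul_sum]
    refine Finset.sum_congr rfl fun t _ => Finset.sum_congr rfl fun s _ => ?_
    rw [map_mul (starRingEnd ℂ), Complex.conj_ofReal, ← AddChar.map_neg_eq_conj,
      show ω * (s - t) = t * -ω + -(s * -ω) by ring, AddChar.map_add_eq_mul]
    ring
  apply Complex.ofReal_injective
  rw [Complex.ofReal_sum, Finset.sum_congr rfl fun ω _ => key ω, Finset.sum_comm]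
  push_cast
  rw [Finset.mul_sum]
  refine Finset.sum_congr rfl fun t _ => ?_
  rw [Finset.sum_comm]
  simp only [← Finset.mul_sum, AddChar.sum_mulShift _ (ZMod.isPrimitive_stdAddChar n3),
    sub_eq_zero, ZMod.card]
  simp
  ring

theorem sqrt_sum_norm_dft_sq {n1 n2 n3 : ℕ} [NeZero n3] (A : T3 n1 n2 n3)
    (i : Fin n1) (j : Fin n2) :
    √(∑ ω : ZMod n3, ‖dft A i j ω‖ ^ 2) = √(n3 : ℝ) * tubeNorm A i j := by
  rw [sum_norm_dft_sq, Real.sqrt_mul n3.cast_nonneg, tubeNorm]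

theorem sum_norm_dft_sq_eq_frobSq {n1 n2 n3 : ℕ} [NeZero n3] (A : T3 n1 n2 n3) :
    ∑ ω : ZMod n3, ∑ i : Fin n1, ∑ j : Fin n2, ‖dft A i j ω‖ ^ 2 = n3 * frobSq A := by
  rw [Finset.sum_comm, frobSq, Finset.mul_sum]
  refine Finset.sum_congr rfl fun i _ => ?_
  rw [Finset.sum_comm, Finset.mul_sum]
  exact Finset.sum_congr rfl fun j _ => sum_norm_dft_sq A i j

theorem natCast_mul_spObj {d n K n3 : ℕ} [NeZero n3] (Y : T3 d n n3) (D : T3 d K n3)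
    (lam : ℝ) (X : T3 K n n3) : (n3 : ℝ) * spObj Y D lam X = fObj Y D lam X := by
  simp only [spObj, fObj, ← dft_tProd, ← dft_sub, sum_norm_dft_sq_eq_frobSq,
    sqrt_sum_norm_dft_sq, ← Finset.mul_sum, norm112]
  linear_combination (-lam * ∑ i, ∑ j, tubeNorm X i j) *
    Real.mul_self_sqrt (Nat.cast_nonneg (α := ℝ) n3)

/-- `n₃·(‖Y − D*X‖_F² + λ‖X‖_{1,1,2})` equals the Fourier-domain
objective `‖Ȳ − D̄X̄‖_F² + λ√n₃‖X̂‖_{1,1,2}` for every `X`; consequently the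
two minimization problems are equivalent. -/
theorem sparse_coding_fourier_equiv {d n K n3 : ℕ} [NeZero n3]
    (Y : T3 d n n3) (D : T3 d K n3) (lam : ℝ) (hlam : 0 < lam) :
    (∀ X : T3 K n n3, (n3 : ℝ) * spObj Y D lam X = fObj Y D lam X) ∧
    (∀ X X' : T3 K n n3, spObj Y D lam X ≤ spObj Y D lam X' ↔
      fObj Y D lam X ≤ fObj Y D lam X') := by
  refine ⟨natCast_mul_spObj Y D lam, fun X X' => ?_⟩
  rw [← natCast_mul_spObj, ← natCast_mul_spObj,
    mul_le_mul_iff_right₀ (Nat.cast_pos.mpr (NeZero.pos n3))]
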